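/- arXiv:1806.00783 — 2 statements merged into one kernel-verified Lean document; each statement's English description precedes it below -/
import Mathlib

section
/- For every natural number k, there exist k-unbalanced digraphs of arbitrarily large chromatic number, i.e., for every m there is a finite k-unbalanced digraph with chromatic number greater than m. -/
/-- A set of `k`-ary edges forms a (k-uniform) directed hypergraph if
no edge has two equal coordinates. -/
def IsHypergraph {V : Type} {k : ℕ} (E : Set (Fin k → V)) : Prop :=
  ∀ e ∈ E, Function.Injective e

/-- The hypergraph `(V, E)` admits a proper coloring with `m` colors:
on each edge, not all vertices receive the same color.  The chromatic number
is at most `m` iff this holds, and is greater than `m` iff it fails. -/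
def Colorable {V : Type} {k : ℕ} (E : Set (Fin k → V)) (m : ℕ) : Prop :=
  ∃ c : V → Fin m, ∀ e ∈ E, ∃ i j : Fin k, c (e i) ≠ c (e j)

/-- The signed step weight of a cycle step: `+1` for a forward edge, `-1` for
a backward edge. -/
def stepWeight {n : ℕ} (d : Fin n → Bool) (i : Fin n) : ℤ :=
  if d i = true then 1 else -1

/-- The excess (number of forward edges minus number of backward edges) of the
stretch of indices `i` with `p ≤ i < q` of a cycle with direction function
`d`. -/
def stretchExcess {n : ℕ} (d : Fin n → Bool) (p q : ℕ) : ℤ :=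
  ∑ i : Fin n, if p ≤ i.1 ∧ i.1 < q then stepWeight d i else 0

/-- A digraph `(V, E)` is `k`-unbalanced if for every cycle (with direction
function `d` recording whether each edge is traversed forward or backward),
either the cycle has exactly as many forward edges as backward edges, or
there are two contiguous non-overlapping stretches of the cycle such that one
stretch has at least `k` more forward edges than backward edges and the other
has at least `k` fewer forward edges than backward edges. -/
def IsUnbalanced {V : Type} (k : ℕ) (E : Set (Fin 2 → V)) : Prop :=
  ∀ (n : ℕ) (v : Fin (n+1) → V) (e : Fin n → (Fin 2 → V)) (d : Fin n → Bool),
    v (Fin.last n) = v 0 →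
    (∀ i : Fin n, e i ∈ E) →
    (∀ i : Fin n, if d i = true then (e i 0 = v i.castSucc ∧ e i 1 = v i.succ)
          else (e i 0 = v i.succ ∧ e i 1 = v i.castSucc)) →
    (∑ i : Fin n, stepWeight d i) = 0 ∨
    ∃ p q r s : ℕ, p ≤ q ∧ q ≤ r ∧ r ≤ s ∧ s ≤ n ∧
      (((k : ℤ) ≤ stretchExcess d p q ∧ stretchExcess d r s ≤ -(k : ℤ)) ∨
       (stretchExcess d p q ≤ -(k : ℤ) ∧ (k : ℤ) ≤ stretchExcess d r s))

/-- Shift relation on tuples of length `r` (padded to functions on `ℕ`). -/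
def ShiftRel (r : ℕ) (u w : ℕ → ℕ) : Prop :=
  (∀ j, j + 1 < r → u (j + 1) = w j) ∧ u 0 < u 1

lemma core_walk (K r : ℕ) (hr : 2 * K + 2 ≤ r) (n : ℕ) (h : ℕ → ℤ) (v : ℕ → ℕ → ℕ)
    (hv : v n = v 0)
    (hs : ∀ i, i < n → (h (i + 1) = h i + 1 ∧ ShiftRel r (v i) (v (i + 1))) ∨
      (h (i + 1) = h i - 1 ∧ ShiftRel r (v (i + 1)) (v i)))
    (hd : ∀ i j, i ≤ j → j ≤ n → h i - h j < K) : h n ≤ h 0 := by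
  by_contra hL
  push Not at hL
  obtain ⟨a, ha, hmax⟩ := Finset.exists_max_image (Finset.range (n + 1)) h ⟨0, by simp⟩
  have ha' : a ≤ n := by simpa [Nat.lt_succ_iff] using ha
  have hmax' : ∀ j, j ≤ n → h j ≤ h a := fun j hj => hmax j (by simp; omega)
  obtain ⟨g0, hg0⟩ := Int.eq_ofNat_of_zero_le (sub_nonneg.mpr (hmax' n le_rfl))
  have key : ∀ i, i ≤ n → ∃ g : ℕ,
      (h i + g = h 0 + g0 ∨ ∃ j, j ≤ i ∧ h j = h i + g) ∧ (∀ j, j ≤ i → h j ≤ h i + g) ∧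
      h 0 + g0 ≤ h i + g ∧ (v 0 g0 : ℤ) + (h i + g - (h 0 + g0)) ≤ v i g := by
    intro i
    induction i with
    | zero =>
      intro _
      refine ⟨g0, Or.inl rfl, ?_, le_rfl, by simp⟩
      intro j hj
      have : j = 0 := by omega
      subst this
      omega
    | succ i ih =>
      intro hi
      obtain ⟨g, h1, h2, h3, h4⟩ := ih (by omega)
      have hgb : g + 2 ≤ 2 * K + 1 := by
        have e1 := hd a n ha' le_rfl
        have e2 := hd 0 i (by omega) (by omega)
        have e3 := hd i i le_rfl (by omega)
        rcases h1 with h1 | ⟨j, hj, h1⟩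
        · omega
        · have := hd j i hj (by omega)
          omega
      rcases hs i (by omega) with ⟨e, s1, s2⟩ | ⟨e, s1, s2⟩
      · rcases g with _ | g
        · refine ⟨0, Or.inr ⟨i + 1, le_rfl, by simp⟩, ?_, by omega, ?_⟩
          · intro j hj
            rcases Nat.lt_or_ge j (i + 1) with hj' | hj'
            · have := h2 j (by omega)
              omega
            · have : j = i + 1 := by omega
              subst this
              omega
          · have := s1 0 (by omega)
            simp only [zero_add] at this
            rw [← this]
            omega
        · refine ⟨g, ?_, ?_, by omega, ?_⟩
          · rcases h1 with h1 | ⟨j, hj, h1⟩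
            · left; omega
            · right; exact ⟨j, by omega, by omega⟩
          · intro j hj
            rcases Nat.lt_or_ge j (i + 1) with hj' | hj'
            · have := h2 j (by omega)
              omega
            · have : j = i + 1 := by omega
              subst this
              omega
          · have := s1 g (by omega)
            rw [← this]
            omega
      · refine ⟨g + 1, ?_, ?_, by omega, ?_⟩
        · rcases h1 with h1 | ⟨j, hj, h1⟩
          · left; omega
          · right; exact ⟨j, by omega, by omega⟩
        · intro j hj
          rcases Nat.lt_or_ge j (i + 1) with hj' | hj'
          · have := h2 j (by omega)
            omega
          · have : j = i + 1 := by omega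
            subst this
            omega
        · have := s1 g (by omega)
          rw [this]
          omega
  obtain ⟨g, h1, h2, h3, h4⟩ := key n le_rfl
  have e1 := h2 a ha'
  have e2 : g = g0 := by
    rcases h1 with h1 | ⟨j, hj, h1⟩
    · omega
    · have := hmax' j hj
      omega
  subst e2
  rw [hv] at h4
  omega

lemma core_walk' (K r : ℕ) (hr : 2 * K + 2 ≤ r) (n : ℕ) (h : ℕ → ℤ) (v : ℕ → ℕ → ℕ)
    (hv : v n = v 0)
    (hs : ∀ i, i < n → (h (i + 1) = h i + 1 ∧ ShiftRel r (v i) (v (i + 1))) ∨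
      (h (i + 1) = h i - 1 ∧ ShiftRel r (v (i + 1)) (v i)))
    (hd : ∀ i j, i ≤ j → j ≤ n → h j - h i < K) : h 0 ≤ h n := by
  have := core_walk K r hr n (fun i => h (n - i)) (fun i => v (n - i)) (by simp [hv])
    (by
      intro i hi
      have e : n - i = n - (i + 1) + 1 := by omega
      have := hs (n - (i + 1)) (by omega)
      rw [← e] at this
      rcases this with ⟨a, b⟩ | ⟨a, b⟩
      · right; exact ⟨by omega, b⟩
      · left; exact ⟨by omega, b⟩)
    (by
      intro i j hij hj
      exact hd _ _ (by omega) (by omega))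
  simpa using this

lemma shift_mono (r : ℕ) : ∀ (C : Type) [Finite C], ∃ N : ℕ,
    ∀ c : (Fin (r + 1) → Fin N) → C, ∃ x : Fin (r + 2) → Fin N, StrictMono x ∧
      c (fun i => x i.castSucc) = c (fun i => x i.succ) := by
  induction r with
  | zero =>
    intro C _
    refine ⟨Nat.card C + 1, fun c => ?_⟩
    have := Fintype.ofFinite C
    obtain ⟨a, b, hab, hc⟩ := Fintype.exists_ne_map_eq_of_card_lt
      (fun z : Fin (Nat.card C + 1) => c (fun _ => z)) (by simp [Nat.card_eq_fintype_card])
    have main : ∀ a b : Fin (Nat.card C + 1), a < b → c (fun _ => a) = c (fun _ => b) →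
        ∃ x : Fin 2 → Fin (Nat.card C + 1), StrictMono x ∧
          c (fun i => x i.castSucc) = c (fun i => x i.succ) := by
      intro a b hab hc
      refine ⟨![a, b], ?_, ?_⟩
      · rw [Fin.strictMono_iff_lt_succ]
        intro i
        fin_cases i
        simpa using hab
      · convert hc using 2
        · funext i; fin_cases i; rfl
        · funext i; fin_cases i; rfl
    rcases lt_or_gt_of_ne hab with h | h
    · exact main a b h hc
    · exact main b a h hc.symm
  | succ r ih =>
    intro C _
    obtain ⟨N, hN⟩ := ih (Set C)
    refine ⟨N, fun c => ?_⟩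
    obtain ⟨x, hx, hc⟩ := hN (fun y => {t | ∃ z, z < y 0 ∧ t = c (Fin.cons z y)})
    have hm : c x ∈ {t | ∃ z, z < (fun i : Fin (r + 1) => x i.succ) 0 ∧
        t = c (Fin.cons z (fun i : Fin (r + 1) => x i.succ))} := by
      refine ⟨x 0, hx (by simp), ?_⟩
      congr 1
      exact (Fin.cons_self_tail x).symm
    rw [← hc] at hm
    obtain ⟨z, hz, hz2⟩ := hm
    refine ⟨Fin.cons z x, ?_, ?_⟩
    · rw [Fin.strictMono_iff_lt_succ]
      intro i
      refine Fin.cases ?_ (fun i => ?_) i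
      · simpa using hz
      · rw [← Fin.succ_castSucc]
        simp only [Fin.cons_succ]
        exact hx (by simp [Fin.lt_def])
    · simp only [Fin.cons_succ]
      refine Eq.trans ?_ hz2.symm
      congr 1
      funext i
      refine Fin.cases ?_ (fun i => ?_) i
      · simp
      · rw [← Fin.succ_castSucc]
        simp only [Fin.cons_succ]

/-- Cumulative excess. -/
def cumulExcess {n : ℕ} (d : Fin n → Bool) (i : ℕ) : ℤ :=
  ∑ t ∈ Finset.range i, if ht : t < n then stepWeight d ⟨t, ht⟩ else 0

lemma stretch_eq {n : ℕ} (d : Fin n → Bool) (p q : ℕ) (hpq : p ≤ q) (hq : q ≤ n) :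
    stretchExcess d p q = cumulExcess d q - cumulExcess d p := by
  unfold stretchExcess cumulExcess
  rw [← Finset.sum_Ico_eq_sub _ hpq]
  have := Fin.sum_univ_eq_sum_range (fun t => if p ≤ t ∧ t < q then
    (if ht : t < n then stepWeight d ⟨t, ht⟩ else 0) else 0) n
  simp only [Fin.is_lt, dite_true, Fin.eta] at this
  rw [this, ← Finset.sum_filter]
  apply Finset.sum_congr _ (fun _ _ => rfl)
  ext t
  simp only [Finset.mem_filter, Finset.mem_range, Finset.mem_Ico]
  omega

lemma total_eq {n : ℕ} (d : Fin n → Bool) :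
    ∑ i : Fin n, stepWeight d i = cumulExcess d n := by
  unfold cumulExcess
  rw [← Fin.sum_univ_eq_sum_range]
  simp

/-- Padding of a tuple to a function on `ℕ`. -/
def padTuple {r N : ℕ} (u : Fin r → Fin N) (j : ℕ) : ℕ :=
  if hj : j < r then (u ⟨j, hj⟩).val else 0

/-- Edges of the shift graph. -/
def shiftEdges (r N : ℕ) : Set (Fin 2 → (Fin r → Fin N)) :=
  {e | ∃ x : Fin (r + 1) → Fin N, StrictMono x ∧
    e 0 = (fun i => x i.castSucc) ∧ e 1 = (fun i => x i.succ)}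

lemma shiftRel_of_edge {r N : ℕ} (hr : 2 ≤ r) {e : Fin 2 → (Fin r → Fin N)}
    (he : e ∈ shiftEdges r N) : ShiftRel r (padTuple (e 0)) (padTuple (e 1)) := by
  obtain ⟨x, hx, h0, h1⟩ := he
  rw [h0, h1]
  constructor
  · intro j hj
    have hj' : j < r := by omega
    simp only [padTuple, hj, hj', dite_true]
    rfl
  · have a0 : 0 < r := by omega
    have a1 : 1 < r := by omega
    simp only [padTuple, a0, a1, dite_true]
    exact hx (by simp [Fin.lt_def])

lemma shift_unbalanced (k r N : ℕ) (hr : 4 * k + 2 ≤ r) :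
    IsUnbalanced k (shiftEdges r N) := by
  intro n v e d hv hE hst
  rw [or_iff_not_imp_left, total_eq]
  intro hne
  have h00 : cumulExcess d 0 = 0 := by simp [cumulExcess]
  by_cases hr2 : 2 ≤ r
  swap
  · have hk : k = 0 := by omega
    subst hk
    refine ⟨0, 0, 0, 0, le_rfl, le_rfl, le_rfl, Nat.zero_le _, ?_⟩
    simp [stretchExcess]
  set V : ℕ → ℕ → ℕ := fun i => padTuple (v ⟨min i n, by omega⟩) with hV
  have hVn : V n = V 0 := by
    have a : (⟨min n n, by omega⟩ : Fin (n + 1)) = Fin.last n := by ext; simp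
    have b : (⟨min 0 n, by omega⟩ : Fin (n + 1)) = 0 := by ext; simp
    simp only [hV]
    rw [a, b, hv]
  have hs : ∀ i, i < n →
      (cumulExcess d (i + 1) = cumulExcess d i + 1 ∧ ShiftRel r (V i) (V (i + 1))) ∨
      (cumulExcess d (i + 1) = cumulExcess d i - 1 ∧ ShiftRel r (V (i + 1)) (V i)) := by
    intro i hi
    have a : (⟨min i n, by omega⟩ : Fin (n + 1)) = (⟨i, hi⟩ : Fin n).castSucc := by
      ext; simp; omega
    have b : (⟨min (i + 1) n, by omega⟩ : Fin (n + 1)) = (⟨i, hi⟩ : Fin n).succ := by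
      ext; simp; omega
    have hstep : cumulExcess d (i + 1) = cumulExcess d i + stepWeight d ⟨i, hi⟩ := by
      unfold cumulExcess
      rw [Finset.sum_range_succ]
      simp [hi]
    have h1 := hst ⟨i, hi⟩
    have h2 := shiftRel_of_edge hr2 (hE ⟨i, hi⟩)
    simp only [hV]
    rw [a, b, hstep]
    unfold stepWeight
    by_cases hdi : d ⟨i, hi⟩ = true
    · rw [if_pos hdi] at h1
      rw [h1.1, h1.2] at h2
      left
      exact ⟨by rw [if_pos hdi], h2⟩
    · rw [if_neg hdi] at h1
      rw [h1.1, h1.2] at h2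
      right
      exact ⟨by rw [if_neg hdi]; ring, h2⟩
  rcases lt_or_gt_of_ne hne with hL | hL
  · have : ∃ i j, i ≤ j ∧ j ≤ n ∧ (2 * k : ℤ) ≤ cumulExcess d j - cumulExcess d i := by
      by_contra hcon
      push Not at hcon
      have := core_walk' (2 * k) r (by omega) n (cumulExcess d) V hVn hs
        (fun i j hij hj => by have := hcon i j hij hj; push_cast; exact this)
      omega
    obtain ⟨i, j, hij, hj, hdrop⟩ := this
    by_cases hc : cumulExcess d i ≤ -(k : ℤ)
    · refine ⟨0, i, i, j, by omega, le_rfl, hij, hj, Or.inr ?_⟩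
      rw [stretch_eq d _ _ (by omega) (by omega), stretch_eq d _ _ hij hj]
      constructor <;> omega
    · refine ⟨i, j, j, n, hij, le_rfl, hj, le_rfl, Or.inl ?_⟩
      rw [stretch_eq d _ _ hij hj, stretch_eq d _ _ hj le_rfl]
      constructor <;> omega
  · have : ∃ i j, i ≤ j ∧ j ≤ n ∧ (2 * k : ℤ) ≤ cumulExcess d i - cumulExcess d j := by
      by_contra hcon
      push Not at hcon
      have := core_walk (2 * k) r (by omega) n (cumulExcess d) V hVn hs
        (fun i j hij hj => by have := hcon i j hij hj; push_cast; exact this)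
      omega
    obtain ⟨i, j, hij, hj, hdrop⟩ := this
    by_cases hc : (k : ℤ) ≤ cumulExcess d i
    · refine ⟨0, i, i, j, by omega, le_rfl, hij, hj, Or.inl ?_⟩
      rw [stretch_eq d _ _ (by omega) (by omega), stretch_eq d _ _ hij hj]
      constructor <;> omega
    · refine ⟨i, j, j, n, hij, le_rfl, hj, le_rfl, Or.inr ?_⟩
      rw [stretch_eq d _ _ hij hj, stretch_eq d _ _ hj le_rfl]
      constructor <;> omega

/-- For every natural number `k`, there exist
`k`-unbalanced digraphs of arbitrarily large chromatic number: for every `m`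
there is a finite `k`-unbalanced digraph with chromatic number greater than
`m`. -/
theorem unbalanced_digraphs_unbounded_chromatic (k : ℕ) :
    ∀ m : ℕ, ∃ (V : Type) (_ : Fintype V) (E : Set (Fin 2 → V)),
      IsHypergraph E ∧ IsUnbalanced k E ∧ ¬ Colorable E m := by
  intro m
  obtain ⟨N, hN⟩ := shift_mono (4 * k + 1) (Fin m)
  refine ⟨Fin (4 * k + 2) → Fin N, inferInstance, shiftEdges (4 * k + 2) N, ?_,
    shift_unbalanced k _ N le_rfl, ?_⟩
  · intro e he
    have hne : e 0 ≠ e 1 := by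
      intro heq
      obtain ⟨x, hx, h0, h1⟩ := he
      rw [h0, h1] at heq
      have h2 := congrFun heq 0
      have h3 : x (Fin.castSucc 0) < x (Fin.succ 0) := hx (by simp [Fin.lt_def])
      exact absurd h2 h3.ne
    intro i j hij
    fin_cases i <;> fin_cases j
    · rfl
    · exact absurd hij hne
    · exact absurd hij.symm hne
    · rfl
  · rintro ⟨c, hc⟩
    obtain ⟨x, hx, hcx⟩ := hN c
    obtain ⟨i, j, hij⟩ := hc ![fun i => x i.castSucc, fun i => x i.succ] ⟨x, hx, rfl, rfl⟩
    apply hij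
    fin_cases i <;> fin_cases j
    · rfl
    · exact hcx
    · exact hcx.symm
    · rfl
end

section
/- Let X be a finite nonempty set and let R ⊆ X × X be a relation which, viewed as a digraph, is smooth, weakly connected, and has algebraic length 1. Then there exists a positive integer k such that for all l, m ≥ k, the relation (R^{∘l} ∘ (R⁻)^{∘m})^{∘k} equals X × X. -/
/-- The `l`-fold composition `R^{∘l}` of a relation with itself
(`R^{∘0}` is the identity relation). -/
def relPow {X : Type} (R : X → X → Prop) : ℕ → X → X → Prop
  | 0 => Eq
  | l + 1 => Relation.Comp (relPow R l) R

theorem rp_add {X : Type} (R : X → X → Prop) (a b : ℕ) (x z : X) :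
    relPow R (a + b) x z ↔ ∃ y, relPow R a x y ∧ relPow R b y z := by
  induction b generalizing z with
  | zero => simp [relPow]
  | succ b ih =>
    rw [← Nat.add_assoc]
    constructor
    · rintro ⟨w, h1, h2⟩
      obtain ⟨y, h3, h4⟩ := (ih w).1 h1
      exact ⟨y, h3, w, h4, h2⟩
    · rintro ⟨y, h3, w, h4, h2⟩
      exact ⟨w, (ih w).2 ⟨y, h3, h4⟩, h2⟩

theorem rp_one {X : Type} (R : X → X → Prop) (x z : X) : relPow R 1 x z ↔ R x z := by
  simp [relPow, Relation.Comp]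

theorem rp_succ_left {X : Type} (R : X → X → Prop) (b : ℕ) (x z : X) :
    relPow R (b + 1) x z ↔ ∃ y, R x y ∧ relPow R b y z := by
  rw [Nat.add_comm, rp_add]
  simp only [rp_one]

theorem rp_flip {X : Type} (R : X → X → Prop) (b : ℕ) (x z : X) :
    relPow (flip R) b x z ↔ relPow R b z x := by
  induction b generalizing x with
  | zero => exact eq_comm
  | succ b ih =>
    rw [rp_succ_left]
    constructor
    · rintro ⟨w, h1, h2⟩
      exact ⟨w, (ih w).1 h2, h1⟩
    · rintro ⟨w, h1, h2⟩
      exact ⟨w, h2, (ih w).2 h1⟩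

theorem rp_total {X : Type} (R : X → X → Prop) (h : ∀ x, ∃ y, R x y) (b : ℕ) (x : X) :
    ∃ y, relPow R b x y := by
  induction b with
  | zero => exact ⟨x, rfl⟩
  | succ b ih =>
    obtain ⟨y, hy⟩ := ih
    obtain ⟨z, hz⟩ := h y
    exact ⟨z, y, hy, hz⟩

theorem rp_mono_refl {X : Type} (R : X → X → Prop) (h : ∀ x, R x x) {a b : ℕ} (hab : a ≤ b)
    (x y : X) (hx : relPow R a x y) : relPow R b x y := by
  induction b, hab using Nat.le_induction with
  | base => exact hx
  | succ n _ ih => exact ⟨y, ih, h y⟩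

theorem rp_mono {X : Type} (R S : X → X → Prop) (h : ∀ x y, R x y → S x y) (a : ℕ)
    (x y : X) (hx : relPow R a x y) : relPow S a x y := by
  induction a generalizing y with
  | zero => exact hx
  | succ n ih =>
    obtain ⟨z, h1, h2⟩ := hx
    exact ⟨z, ih z h1, h z y h2⟩

theorem rp_of_rtg {X : Type} (R : X → X → Prop) (x y : X) (h : Relation.ReflTransGen R x y) :
    ∃ n, relPow R n x y := by
  induction h with
  | refl => exact ⟨0, rfl⟩
  | tail _ h ih =>
    obtain ⟨n, hn⟩ := ih
    exact ⟨n + 1, _, hn, h⟩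

/-- Points with a common `l`-step successor. -/
def cs {X : Type} (R : X → X → Prop) (l : ℕ) (x y : X) : Prop :=
  ∃ z, relPow R l x z ∧ relPow R l y z

theorem cs_mono {X : Type} (R : X → X → Prop) (h : ∀ x, ∃ y, R x y) {a b : ℕ} (hab : a ≤ b)
    (x y : X) (hx : cs R a x y) : cs R b x y := by
  induction b, hab using Nat.le_induction with
  | base => exact hx
  | succ n _ ih =>
    obtain ⟨z, h1, h2⟩ := ih
    obtain ⟨w, hw⟩ := h z
    exact ⟨w, ⟨z, h1, hw⟩, ⟨z, h2, hw⟩⟩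

theorem cs_refl {X : Type} (R : X → X → Prop) (h : ∀ x, ∃ y, R x y) (a : ℕ) (x : X) :
    cs R a x x := by
  obtain ⟨y, hy⟩ := rp_total R h a x
  exact ⟨y, hy, hy⟩

theorem cs_pull {X : Type} (R : X → X → Prop) {a : ℕ} {x y x' y' : X} (h : cs R a y y')
    (h1 : R x y) (h2 : R x' y') : cs R (a + 1) x x' := by
  obtain ⟨z, hz, hz'⟩ := h
  exact ⟨z, (rp_succ_left R a x z).2 ⟨y, h1, hz⟩, (rp_succ_left R a x' z).2 ⟨y', h2, hz'⟩⟩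

theorem exists_unif {X : Type} [Fintype X] (P : ℕ → X → X → Prop)
    (hm : ∀ a b, a ≤ b → ∀ x y, P a x y → P b x y) :
    ∃ L, ∀ l x y, P l x y → P L x y := by
  classical
  have : ∀ p : X × X, ∃ n, ∀ l, P l p.1 p.2 → P n p.1 p.2 := by
    intro p
    by_cases h : ∃ l, P l p.1 p.2
    · obtain ⟨l, hl⟩ := h
      exact ⟨l, fun _ _ => hl⟩
    · exact ⟨0, fun l hl => absurd ⟨l, hl⟩ h⟩
  choose f hf using this
  refine ⟨Finset.univ.sup f, fun l x y h => ?_⟩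
  exact hm (f (x, y)) _ (Finset.le_sup (f := f) (Finset.mem_univ (x, y))) x y (hf (x, y) l h)

theorem perm_walk {X Q : Type} (R : X → X → Prop) (q : X → Q) (e : Equiv.Perm Q)
    (he : ∀ x y, R x y → e (q x) = q y) (n : ℕ) (v : Fin (n+1) → X) (d : Fin n → Bool)
    (hv : ∀ i : Fin n, if d i = true then R (v i.castSucc) (v i.succ)
        else R (v i.succ) (v i.castSucc)) :
    (e ^ (∑ i : Fin n, if d i = true then (1 : ℤ) else -1)) (q (v 0)) = q (v (Fin.last n)) := by
  induction n with
  | zero => simp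
  | succ n ih =>
    have h := ih (fun i => v i.castSucc) (fun i => d i.castSucc) (fun i => hv i.castSucc)
    rw [Fin.sum_univ_castSucc, add_comm, zpow_add, Equiv.Perm.mul_apply]
    have h' : (e ^ (∑ i : Fin n, if d i.castSucc = true then (1 : ℤ) else -1)) (q (v 0))
      = q (v (Fin.last n).castSucc) := h
    rw [h']
    have h2 := hv (Fin.last n)
    split_ifs at h2 ⊢ with hd
    · simpa using he _ _ h2
    · rw [zpow_neg_one, Equiv.Perm.inv_eq_iff_eq]
      exact (he _ _ h2).symm

theorem theta_full {X : Type} [Fintype X] (R : X → X → Prop)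
    (hsmooth : ∀ x : X, (∃ y, R x y) ∧ (∃ y, R y x))
    (hconn : ∀ x y : X, Relation.ReflTransGen (fun a b => R a b ∨ R b a) x y)
    (halg : ∃ (n : ℕ) (v : Fin (n+1) → X) (d : Fin n → Bool),
      v (Fin.last n) = v 0 ∧
      (∀ i : Fin n, if d i = true then R (v i.castSucc) (v i.succ)
        else R (v i.succ) (v i.castSucc)) ∧
      (∑ i : Fin n, if d i = true then (1 : ℤ) else -1) = 1)
    (θ : X → X → Prop) (hθ : Equivalence θ)
    (hp : ∀ x y x' y', R x y → R x' y' → θ y y' → θ x x') : ∀ x y, θ x y := by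
  classical
  let s : Setoid X := ⟨θ, hθ⟩
  choose pr hpr using fun x => (hsmooth x).2
  let f : Quotient s → Quotient s := Quotient.map pr
    (fun a b hab => hp _ _ _ _ (hpr a) (hpr b) hab)
  have hf : ∀ x y, R x y → f (Quotient.mk s y) = Quotient.mk s x := by
    intro x y h
    exact Quotient.sound (s := s) (hp _ _ _ _ (hpr y) h (hθ.refl y))
  have hsurj : Function.Surjective f := by
    intro a
    induction a using Quotient.inductionOn with
    | h x =>
      obtain ⟨y, hy⟩ := (hsmooth x).1
      exact ⟨Quotient.mk s y, hf x y hy⟩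
  have hbij : Function.Bijective f := ⟨Finite.injective_iff_surjective.2 hsurj, hsurj⟩
  let e : Equiv.Perm (Quotient s) := (Equiv.ofBijective f hbij).symm
  have he : ∀ x y, R x y → e (Quotient.mk s x) = Quotient.mk s y := by
    intro x y h
    rw [Equiv.symm_apply_eq]
    exact (hf x y h).symm
  obtain ⟨n, v, d, h1, h2, h3⟩ := halg
  have hw := perm_walk R (Quotient.mk s) e he n v d h2
  rw [h3, h1, zpow_one] at hw
  have key : ∀ y, Quotient.mk s y = Quotient.mk s (v 0) := by
    intro y
    induction hconn (v 0) y with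
    | refl => rfl
    | tail _ h ih =>
      rcases h with h | h
      · rw [← he _ _ h, ih, hw]
      · apply e.injective
        rw [he _ _ h, ih, hw]
  intro x y
  exact Quotient.exact (s := s) ((key x).trans (key y).symm)

/-- `(A ∘ S)^k ⊇ A^k ∘ S^k` when `A ∘ S ⊆ S ∘ A`. -/
theorem comp_pow {X : Type} (A S : X → X → Prop)
    (h : ∀ x y z, A x y → S y z → ∃ w, S x w ∧ A w z) (k : ℕ) (x y z : X)
    (h1 : relPow A k x y) (h2 : relPow S k y z) : relPow (Relation.Comp A S) k x z := by
  have hk : ∀ k x y z, relPow A k x y → S y z → ∃ w, S x w ∧ relPow A k w z := by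
    intro k
    induction k with
    | zero =>
      rintro x y z rfl hs
      exact ⟨z, hs, rfl⟩
    | succ k ih =>
      rintro x y z ⟨u, hu, hy⟩ hs
      obtain ⟨w, hw, hz⟩ := h _ _ _ hy hs
      obtain ⟨t, ht, ht'⟩ := ih _ _ _ hu hw
      exact ⟨t, ht, w, ht', hz⟩
  induction k generalizing x y with
  | zero => exact Eq.trans h1 h2
  | succ k ih =>
    obtain ⟨u, hu, hu'⟩ := (rp_succ_left A k x y).1 h1
    obtain ⟨t, ht, ht'⟩ := (rp_succ_left S k y z).1 h2
    obtain ⟨w, hw, hw'⟩ := hk k _ _ _ hu' ht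
    exact (rp_succ_left _ k x z).2 ⟨w, ⟨u, hu, hw⟩, ih w t hw' ht'⟩


/-- Let `X` be a finite nonempty set and `R ⊆ X × X` a
relation which, viewed as a digraph, is smooth, weakly connected, and has
algebraic length 1.  Then there is a positive integer `k` such that for all
`l, m ≥ k`, `(R^{∘l} ∘ (R⁻)^{∘m})^{∘k} = X × X`. -/
theorem smooth_connected_algebraic_length_one_power_full
    {X : Type} [Fintype X] [Nonempty X] (R : X → X → Prop)
    (hsmooth : ∀ x : X, (∃ y, R x y) ∧ (∃ y, R y x))
    (hconn : ∀ x y : X, Relation.ReflTransGen (fun a b => R a b ∨ R b a) x y)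
    (halg : ∃ (n : ℕ) (v : Fin (n+1) → X) (d : Fin n → Bool),
      v (Fin.last n) = v 0 ∧
      (∀ i : Fin n, if d i = true then R (v i.castSucc) (v i.succ)
        else R (v i.succ) (v i.castSucc)) ∧
      (∑ i : Fin n, if d i = true then (1 : ℤ) else -1) = 1) :
    ∃ k : ℕ, 0 < k ∧ ∀ l m : ℕ, k ≤ l → k ≤ m →
      ∀ x y : X, relPow (Relation.Comp (relPow R l) (relPow (flip R) m)) k x y := by
  obtain ⟨L, hL⟩ := exists_unif (cs R) (fun a b hab => cs_mono R (fun x => (hsmooth x).1) hab)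
  have htot : ∀ x, ∃ y, R x y := fun x => (hsmooth x).1
  have hsymm : ∀ x y, cs R L x y → cs R L y x := fun x y ⟨z, h1, h2⟩ => ⟨z, h2, h1⟩
  have hfull : ∀ x y, Relation.ReflTransGen (cs R L) x y := by
    refine theta_full R hsmooth hconn halg (Relation.ReflTransGen (cs R L))
      ⟨fun _ => .refl, fun {x y} h => ?_, fun h1 h2 => h1.trans h2⟩ ?_
    · induction h with
      | refl => exact .refl
      | tail _ h ih => exact Relation.ReflTransGen.head (hsymm _ _ h) ih
    · intro x y x' y' h1 h2 h
      induction h generalizing x' with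
      | refl => exact .single (hL _ _ _ (cs_pull R (cs_refl R htot L y) h1 h2))
      | @tail b c _ h ih =>
        obtain ⟨w, hw⟩ := (hsmooth b).2
        exact (ih w hw).tail (hL _ _ _ (cs_pull R h hw h2))
  obtain ⟨K, hK⟩ := exists_unif (relPow (cs R L))
    (fun a b hab => rp_mono_refl _ (cs_refl R htot L) hab)
  have hK' : ∀ x y, relPow (cs R L) K x y := by
    intro x y
    obtain ⟨n, hn⟩ := rp_of_rtg _ _ _ (hfull x y)
    exact hK n x y hn
  have main : ∀ l m : ℕ, L + K + 1 ≤ m → m ≤ l → ∀ x y : X,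
      relPow (Relation.Comp (relPow R l) (relPow (flip R) m)) (L + K + 1) x y := by
    intro l m hm hlm x y
    obtain ⟨d, rfl⟩ := Nat.exists_eq_add_of_le' hlm
    have hcomm : ∀ d x y z, relPow R d x y → cs R m y z →
        ∃ w, cs R m x w ∧ relPow R d w z := by
      intro d x y z h1 h2
      obtain ⟨w, hw⟩ := rp_total (flip R) (fun x => (hsmooth x).2) d z
      rw [rp_flip] at hw
      obtain ⟨u, hu, hu'⟩ := h2
      refine ⟨w, cs_mono R htot (by omega) _ _ (hL (d + m) x w
        ⟨u, (rp_add R d m x u).2 ⟨y, h1, hu⟩, (rp_add R d m w u).2 ⟨z, hw, hu'⟩⟩), hw⟩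
    obtain ⟨t, ht⟩ := rp_total (relPow R d) (rp_total R htot d) (L + K + 1) x
    have hS : relPow (cs R m) (L + K + 1) t y :=
      rp_mono_refl _ (cs_refl R htot m) (by omega) _ _
        (rp_mono _ _ (fun a b => cs_mono R htot (by omega) a b) _ _ _ (hK' t y))
    refine rp_mono _ _ ?_ _ _ _ (comp_pow _ _ (hcomm d) _ x t y ht hS)
    rintro a b ⟨c, hc, z, hz, hz'⟩
    exact ⟨z, (rp_add R d m a z).2 ⟨c, hc, hz⟩, (rp_flip R m z b).2 hz'⟩
  refine ⟨L + K + 1, by omega, fun l m hl hm x y => ?_⟩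
  rcases le_total m l with h | h
  · exact main l m hm h x y
  · rw [← rp_flip]
    refine rp_mono _ _ ?_ _ _ _ (main m l hl h y x)
    rintro a b ⟨c, hc, hc'⟩
    exact ⟨c, (rp_flip R l c b).1 hc', (rp_flip R m c a).2 hc⟩
end
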